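/- Hamilton–Jacobi variational principle is equivalent to the Hamilton–De Donder–Weyl equations (coordinate version of Theorem 2, items 1 ⟺ 3): Let h : J → ℝ be smooth and let y : (Fin m → ℝ) → (Fin n → ℝ), p : (Fin m → ℝ) → (Fin n → Fin m → ℝ) be smooth. Then (y, p) is a critical section of the Hamiltonian action if and only if (y, p) satisfies the Hamilton–De Donder–Weyl equations at every point. -/

import Mathlib

open MeasureTheory

/-- Partial derivative of a real-valued function on `Fin m → ℝ` in the `ν`-th
coordinate direction. -/
noncomputable def pd {m : ℕ} (f : (Fin m → ℝ) → ℝ) (ν : Fin m) (x : Fin m → ℝ) : ℝ :=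
  fderiv ℝ f x (Pi.single ν 1)

/-- First jet prolongation of `φ`. -/
noncomputable def j1 {m n : ℕ} (φ : (Fin m → ℝ) → (Fin n → ℝ)) (x : Fin m → ℝ) :
    (Fin m → ℝ) × (Fin n → ℝ) × (Fin n → Fin m → ℝ) :=
  (x, φ x, fun A ν => pd (fun x' => φ x' A) ν x)

/-- Partial derivative of the Lagrangian in the `y^A` slot. -/
noncomputable def Ly {m n : ℕ} (L : (Fin m → ℝ) × (Fin n → ℝ) × (Fin n → Fin m → ℝ) → ℝ)
    (z : (Fin m → ℝ) × (Fin n → ℝ) × (Fin n → Fin m → ℝ)) (A : Fin n) : ℝ :=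
  fderiv ℝ L z (0, Pi.single A 1, 0)

/-- Partial derivative of the Lagrangian in the `v^A_ν` slot. -/
noncomputable def Lv {m n : ℕ} (L : (Fin m → ℝ) × (Fin n → ℝ) × (Fin n → Fin m → ℝ) → ℝ)
    (z : (Fin m → ℝ) × (Fin n → ℝ) × (Fin n → Fin m → ℝ)) (A : Fin n) (ν : Fin m) : ℝ :=
  fderiv ℝ L z (0, 0, Pi.single A (Pi.single ν 1))


theorem hasDerivAt_integral_of_isCompact {X : Type*} [TopologicalSpace X] [T2Space X]
    [MeasurableSpace X] [OpensMeasurableSpace X] {μ : Measure X} [IsFiniteMeasureOnCompacts μ]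
    {F F' : ℝ → X → ℝ} {K : Set X} (hK : IsCompact K)
    (hF : ∀ t, Continuous (F t)) (hF' : Continuous (Function.uncurry F'))
    (hFK : ∀ t, ∀ x ∉ K, F t x = 0) (hFK' : ∀ t, ∀ x ∉ K, F' t x = 0)
    (hderiv : ∀ t x, HasDerivAt (fun s => F s x) (F' t x) t) (t₀ : ℝ) :
    HasDerivAt (fun t => ∫ x, F t x ∂μ) (∫ x, F' t₀ x ∂μ) t₀ := by
  have hF₀' : Continuous (F' t₀) := hF'.comp (by fun_prop : Continuous fun x : X => (t₀, x))
  obtain ⟨C, hC⟩ := ((isCompact_closedBall t₀ 1).prod hK).exists_bound_of_continuousOn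
    hF'.continuousOn
  have hcs : ∀ t, HasCompactSupport (F t) := fun t => HasCompactSupport.intro hK (hFK t)
  have hcs' : HasCompactSupport (F' t₀) := HasCompactSupport.intro hK (hFK' t₀)
  have hint : ∀ t, Integrable (F t) μ := fun t => (hF t).integrable_of_hasCompactSupport (hcs t)
  refine (hasDerivAt_integral_of_dominated_loc_of_deriv_le
    (bound := K.indicator fun _ => C) (Metric.ball_mem_nhds t₀ one_pos)
    (Filter.Eventually.of_forall fun t => (hint t).aestronglyMeasurable) (hint t₀)
    (hF₀'.integrable_of_hasCompactSupport hcs').aestronglyMeasurable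
    (Filter.Eventually.of_forall fun x t ht => ?_) ?_
    (Filter.Eventually.of_forall fun x t _ => hderiv t x)).2
  · by_cases hx : x ∈ K
    · simpa [hx] using hC (t, x) ⟨Metric.ball_subset_closedBall ht, hx⟩
    · simp [hx, hFK' t x hx]
  · exact (integrable_indicator_iff hK.measurableSet).2
      (integrableOn_const hK.measure_lt_top.ne)

section PartialDerivative

variable {m : ℕ} {f g : (Fin m → ℝ) → ℝ}

theorem continuous_pd (hf : ContDiff ℝ (⊤ : ℕ∞) f) (ν : Fin m) : Continuous (pd f ν) :=
  (hf.continuous_fderiv (by simp)).clm_apply continuous_const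

theorem pd_add_const_mul (hf : Differentiable ℝ f) (hg : Differentiable ℝ g) (t : ℝ) (ν : Fin m)
    (x : Fin m → ℝ) : pd (fun x' => f x' + t * g x') ν x = pd f ν x + t * pd g ν x := by
  simp only [pd]
  rw [fderiv_fun_add (hf x) ((hg x).const_mul t), fderiv_const_mul (hg x)]
  simp

theorem pd_eq_zero_of_notMem_tsupport {x : Fin m → ℝ} (hx : x ∉ tsupport f) (ν : Fin m) :
    pd f ν x = 0 := by
  have : fderiv ℝ f x = 0 := by
    by_contra hne
    exact hx (support_fderiv_subset ℝ hne)
  simp [pd, this]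

theorem integral_mul_pd_eq_neg (hf : ContDiff ℝ (⊤ : ℕ∞) f) (hg : ContDiff ℝ (⊤ : ℕ∞) g)
    (hgs : HasCompactSupport g) (ν : Fin m) :
    ∫ x, f x * pd g ν x = -∫ x, pd f ν x * g x := by
  have hgs' : HasCompactSupport (pd g ν) :=
    HasCompactSupport.intro hgs fun x hx => pd_eq_zero_of_notMem_tsupport hx ν
  exact integral_mul_fderiv_eq_neg_fderiv_mul_of_integrable
    (((continuous_pd hf ν).mul hg.continuous).integrable_of_hasCompactSupport hgs.mul_left)
    ((hf.continuous.mul (continuous_pd hg ν)).integrable_of_hasCompactSupport hgs'.mul_left)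
    ((hf.continuous.mul hg.continuous).integrable_of_hasCompactSupport hgs.mul_left)
    (fun x _ => hf.differentiable (by simp) x) (fun x _ => hg.differentiable (by simp) x)

/-- The fundamental lemma of the calculus of variations, for continuous functions. -/
theorem eq_zero_of_forall_integral_smooth_mul_eq_zero (hf : Continuous f)
    (H : ∀ g : (Fin m → ℝ) → ℝ, ContDiff ℝ (⊤ : ℕ∞) g → HasCompactSupport g →
      ∫ x, g x * f x = 0) (x : Fin m → ℝ) : f x = 0 := by
  have hae : f =ᵐ[volume] fun _ => 0 :=
    ae_eq_zero_of_integral_contDiff_smul_eq_zero hf.locallyIntegrable H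
  exact congrFun ((hf.ae_eq_iff_eq volume continuous_const).1 hae) x

end PartialDerivative

section FirstVariation

variable {m n : ℕ} {h : (Fin m → ℝ) × (Fin n → ℝ) × (Fin n → Fin m → ℝ) → ℝ}

theorem fderiv_vertical_apply (z : (Fin m → ℝ) × (Fin n → ℝ) × (Fin n → Fin m → ℝ))
    (Z : Fin n → ℝ) (W : Fin n → Fin m → ℝ) :
    fderiv ℝ h z (0, Z, W) =
      (∑ A, Z A * Ly h z A) + ∑ A, ∑ ν, W A ν * Lv h z A ν := by
  have hv : ((0, Z, W) : (Fin m → ℝ) × (Fin n → ℝ) × (Fin n → Fin m → ℝ)) =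
      (∑ A, Z A • ((0, Pi.single A 1, 0) : (Fin m → ℝ) × (Fin n → ℝ) × (Fin n → Fin m → ℝ))) +
      ∑ A, ∑ ν, W A ν • ((0, 0, Pi.single A (Pi.single ν 1)) :
        (Fin m → ℝ) × (Fin n → ℝ) × (Fin n → Fin m → ℝ)) := by
    refine Prod.ext ?_ (Prod.ext ?_ ?_)
    · simp [Prod.fst_sum]
    · ext B
      simp [Prod.fst_sum, Prod.snd_sum, Finset.sum_apply, Pi.single_apply]
    · ext B μ
      simp [Prod.snd_sum, Finset.sum_apply, Pi.single_apply]
  rw [hv]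
  simp only [map_add, map_sum, map_smul, smul_eq_mul, Ly, Lv]

theorem continuous_Lv_comp (hh : ContDiff ℝ (⊤ : ℕ∞) h) {X : Type*} [TopologicalSpace X]
    {z : X → (Fin m → ℝ) × (Fin n → ℝ) × (Fin n → Fin m → ℝ)} (hz : Continuous z)
    (A : Fin n) (ν : Fin m) : Continuous fun x => Lv h (z x) A ν :=
  ((hh.continuous_fderiv (by simp)).comp hz).clm_apply continuous_const

theorem continuous_Ly_comp (hh : ContDiff ℝ (⊤ : ℕ∞) h) {X : Type*} [TopologicalSpace X]
    {z : X → (Fin m → ℝ) × (Fin n → ℝ) × (Fin n → Fin m → ℝ)} (hz : Continuous z)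
    (A : Fin n) : Continuous fun x => Ly h (z x) A :=
  ((hh.continuous_fderiv (by simp)).comp hz).clm_apply continuous_const

variable {y Z : (Fin m → ℝ) → (Fin n → ℝ)} {p W : (Fin m → ℝ) → (Fin n → Fin m → ℝ)}

/-- The first variation of the Hamiltonian action, before integrating by parts. -/
theorem hasDerivAt_hamiltonian_action (hh : ContDiff ℝ (⊤ : ℕ∞) h)
    (hy : ContDiff ℝ (⊤ : ℕ∞) y) (hp : ContDiff ℝ (⊤ : ℕ∞) p)
    (hZ : ContDiff ℝ (⊤ : ℕ∞) Z) (hZs : HasCompactSupport Z)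
    (hW : ContDiff ℝ (⊤ : ℕ∞) W) (hWs : HasCompactSupport W) :
    HasDerivAt
      (fun t : ℝ => ∫ x : Fin m → ℝ,
        ((∑ A : Fin n, ∑ ν : Fin m,
            (p x A ν + t * W x A ν) * pd (fun x' => y x' A + t * Z x' A) ν x)
          - h (x, y x + t • Z x, p x + t • W x)
        - ((∑ A : Fin n, ∑ ν : Fin m, p x A ν * pd (fun x' => y x' A) ν x)
          - h (x, y x, p x))))
      (∫ x, ((∑ A, ∑ ν, (W x A ν * pd (fun x' => y x' A) ν x +
          p x A ν * pd (fun x' => Z x' A) ν x)) - fderiv ℝ h (x, y x, p x) (0, Z x, W x))) 0 := by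
  have hyA : ∀ A, ContDiff ℝ (⊤ : ℕ∞) fun x => y x A := contDiff_pi.1 hy
  have hZA : ∀ A, ContDiff ℝ (⊤ : ℕ∞) fun x => Z x A := contDiff_pi.1 hZ
  have hyc := hy.continuous
  have hZc := hZ.continuous
  have hpc := hp.continuous
  have hWc := hW.continuous
  have hhc := hh.continuous
  have hpdy : ∀ A ν, Continuous (pd (fun x => y x A) ν) := fun A ν => continuous_pd (hyA A) ν
  have hpdZ : ∀ A ν, Continuous (pd (fun x => Z x A) ν) := fun A ν => continuous_pd (hZA A) ν
  have hZ₀ : ∀ x ∉ tsupport Z ∪ tsupport W, Z x = 0 := fun x hx =>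
    image_eq_zero_of_notMem_tsupport fun hx' => hx (Or.inl hx')
  have hW₀ : ∀ x ∉ tsupport Z ∪ tsupport W, W x = 0 := fun x hx =>
    image_eq_zero_of_notMem_tsupport fun hx' => hx (Or.inr hx')
  have hpdZ₀ : ∀ x ∉ tsupport Z ∪ tsupport W, ∀ A ν, pd (fun x => Z x A) ν x = 0 := by
    intro x hx A ν
    refine pd_eq_zero_of_notMem_tsupport (fun hx' => hx (Or.inl ?_)) ν
    refine closure_mono (fun x' hx'' => ?_) hx'
    intro h0
    exact hx'' (by simp [h0])
  simp only [pd_add_const_mul ((hyA _).differentiable (by simp))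
    ((hZA _).differentiable (by simp))]
  convert hasDerivAt_integral_of_isCompact (μ := volume) (K := tsupport Z ∪ tsupport W)
    (F' := fun t x => (∑ A, ∑ ν,
      (W x A ν * (pd (fun x' => y x' A) ν x + t * pd (fun x' => Z x' A) ν x) +
        (p x A ν + t * W x A ν) * pd (fun x' => Z x' A) ν x)) -
      fderiv ℝ h (x, y x + t • Z x, p x + t • W x) (0, Z x, W x))
    (hZs.isCompact.union hWs.isCompact) ?_ ?_ ?_ ?_ ?_ 0 using 1
  · simp
  · intro t
    fun_prop
  · refine Continuous.sub (by fun_prop) ?_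
    exact ((hh.continuous_fderiv (by simp)).comp (by fun_prop)).clm_apply (by fun_prop)
  · intro t x hx
    simp [hZ₀ x hx, hW₀ x hx, hpdZ₀ x hx]
  · intro t x hx
    have h0 : ((0, 0, 0) : (Fin m → ℝ) × (Fin n → ℝ) × (Fin n → Fin m → ℝ)) = 0 := rfl
    simp [hZ₀ x hx, hW₀ x hx, hpdZ₀ x hx, h0]
  · intro t x
    refine (HasDerivAt.sub (HasDerivAt.fun_sum fun A _ => HasDerivAt.fun_sum fun ν _ => ?_)
      ?_).sub_const _
    · have h1 := ((hasDerivAt_id t).mul_const (W x A ν)).const_add (p x A ν)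
      have h2 := ((hasDerivAt_id t).mul_const (pd (fun x' => Z x' A) ν x)).const_add
        (pd (fun x' => y x' A) ν x)
      simpa using h1.fun_mul h2
    · have h1 := ((hasDerivAt_id t).smul_const (Z x)).const_add (y x)
      have h2 := ((hasDerivAt_id t).smul_const (W x)).const_add (p x)
      have h3 := (hasDerivAt_const t x).prodMk (h1.prodMk h2)
      simp only [one_smul] at h3
      exact ((hh.differentiable (by simp)) _).hasFDerivAt.comp_hasDerivAt t h3

/-- Integration by parts in the first variation of the Hamiltonian action. -/
theorem integral_hamiltonian_variation (hh : ContDiff ℝ (⊤ : ℕ∞) h)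
    (hy : ContDiff ℝ (⊤ : ℕ∞) y) (hp : ContDiff ℝ (⊤ : ℕ∞) p)
    (hZ : ContDiff ℝ (⊤ : ℕ∞) Z) (hZs : HasCompactSupport Z)
    (hW : ContDiff ℝ (⊤ : ℕ∞) W) (hWs : HasCompactSupport W) :
    ∫ x, ((∑ A, ∑ ν, (W x A ν * pd (fun x' => y x' A) ν x +
        p x A ν * pd (fun x' => Z x' A) ν x)) - fderiv ℝ h (x, y x, p x) (0, Z x, W x)) =
      (∑ A, ∑ ν, ∫ x, W x A ν * (pd (fun x' => y x' A) ν x - Lv h (x, y x, p x) A ν)) -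
        ∑ A, ∫ x, Z x A * (∑ ν, pd (fun x' => p x' A ν) ν x + Ly h (x, y x, p x) A) := by
  have hyA : ∀ A, ContDiff ℝ (⊤ : ℕ∞) fun x => y x A := contDiff_pi.1 hy
  have hZA : ∀ A, ContDiff ℝ (⊤ : ℕ∞) fun x => Z x A := contDiff_pi.1 hZ
  have hpA : ∀ A ν, ContDiff ℝ (⊤ : ℕ∞) fun x => p x A ν := fun A =>
    contDiff_pi.1 (contDiff_pi.1 hp A)
  have hWA : ∀ A ν, ContDiff ℝ (⊤ : ℕ∞) fun x => W x A ν := fun A =>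
    contDiff_pi.1 (contDiff_pi.1 hW A)
  have hZsA : ∀ A, HasCompactSupport fun x => Z x A := fun A =>
    hZs.comp_left (g := fun v : Fin n → ℝ => v A) rfl
  have hWsA : ∀ A ν, HasCompactSupport fun x => W x A ν := fun A ν =>
    hWs.comp_left (g := fun v : Fin n → Fin m → ℝ => v A ν) rfl
  have hpdZs : ∀ A ν, HasCompactSupport (pd (fun x => Z x A) ν) := fun A ν =>
    HasCompactSupport.intro (hZsA A) fun x hx => pd_eq_zero_of_notMem_tsupport hx ν
  have hz : Continuous fun x => (x, y x, p x) :=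
    continuous_id.prodMk (hy.continuous.prodMk hp.continuous)
  have iW : ∀ A ν, Integrable fun x =>
      W x A ν * (pd (fun x' => y x' A) ν x - Lv h (x, y x, p x) A ν) := fun A ν =>
    ((hWA A ν).continuous.mul ((continuous_pd (hyA A) ν).sub
      (continuous_Lv_comp hh hz A ν))).integrable_of_hasCompactSupport (hWsA A ν).mul_right
  have ipZ : ∀ A ν, Integrable fun x => p x A ν * pd (fun x' => Z x' A) ν x := fun A ν =>
    ((hpA A ν).continuous.mul (continuous_pd (hZA A) ν)).integrable_of_hasCompactSupport
      (hpdZs A ν).mul_left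
  have iZp : ∀ A ν, Integrable fun x => pd (fun x' => p x' A ν) ν x * Z x A := fun A ν =>
    ((continuous_pd (hpA A ν) ν).mul (hZA A).continuous).integrable_of_hasCompactSupport
      (hZsA A).mul_left
  have iZ : ∀ A, Integrable fun x => Z x A * Ly h (x, y x, p x) A := fun A =>
    ((hZA A).continuous.mul (continuous_Ly_comp hh hz A)).integrable_of_hasCompactSupport
      (hZsA A).mul_right
  have hsplit : ∀ x, (∑ A, ∑ ν, (W x A ν * pd (fun x' => y x' A) ν x +
      p x A ν * pd (fun x' => Z x' A) ν x)) - fderiv ℝ h (x, y x, p x) (0, Z x, W x) =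
      (∑ A, ∑ ν, W x A ν * (pd (fun x' => y x' A) ν x - Lv h (x, y x, p x) A ν)) +
      ((∑ A, ∑ ν, p x A ν * pd (fun x' => Z x' A) ν x) -
        ∑ A, Z x A * Ly h (x, y x, p x) A) := by
    intro x
    rw [fderiv_vertical_apply]
    simp only [mul_sub, Finset.sum_add_distrib, Finset.sum_sub_distrib]
    ring
  have hparts : ∀ A,
      ∫ x, Z x A * (∑ ν, pd (fun x' => p x' A ν) ν x + Ly h (x, y x, p x) A) =
        -(∑ ν, ∫ x, p x A ν * pd (fun x' => Z x' A) ν x) +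
          ∫ x, Z x A * Ly h (x, y x, p x) A := by
    intro A
    simp only [integral_mul_pd_eq_neg (hpA A _) (hZA A) (hZsA A), Finset.sum_neg_distrib, neg_neg]
    rw [← integral_finsetSum _ fun ν _ => iZp A ν,
      ← integral_add (integrable_finsetSum _ fun ν _ => iZp A ν) (iZ A)]
    refine integral_congr_ae (Filter.Eventually.of_forall fun x => ?_)
    simp only [mul_add, Finset.mul_sum, mul_comm]
  have iWs := integrable_finsetSum Finset.univ fun A _ =>
    integrable_finsetSum Finset.univ fun ν _ => iW A ν
  have ipZs := integrable_finsetSum Finset.univ fun A _ =>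
    integrable_finsetSum Finset.univ fun ν _ => ipZ A ν
  have iZs := integrable_finsetSum Finset.univ fun A _ => iZ A
  simp only [hsplit, hparts]
  rw [integral_add iWs (ipZs.sub' iZs), integral_sub ipZs iZs,
    integral_finsetSum _ fun A _ => integrable_finsetSum Finset.univ fun ν _ => iW A ν,
    integral_finsetSum _ fun A _ => integrable_finsetSum Finset.univ fun ν _ => ipZ A ν,
    integral_finsetSum _ fun A _ => iZ A]
  simp only [integral_finsetSum _ fun ν _ => iW _ ν, integral_finsetSum _ fun ν _ => ipZ _ ν,
    Finset.sum_add_distrib, Finset.sum_neg_distrib]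
  ring

end FirstVariation

/-- Hamilton–Jacobi variational principle ⟺ Hamilton–De Donder–Weyl equations. -/
theorem hamiltonian_critical_section_iff_HDW
    (m n : ℕ) (hm : 0 < m) (hn : 0 < n)
    (h : (Fin m → ℝ) × (Fin n → ℝ) × (Fin n → Fin m → ℝ) → ℝ) (hh : ContDiff ℝ (⊤ : ℕ∞) h)
    (y : (Fin m → ℝ) → (Fin n → ℝ)) (hy : ContDiff ℝ (⊤ : ℕ∞) y)
    (p : (Fin m → ℝ) → (Fin n → Fin m → ℝ)) (hp : ContDiff ℝ (⊤ : ℕ∞) p) :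
    (∀ (Z : (Fin m → ℝ) → (Fin n → ℝ)) (W : (Fin m → ℝ) → (Fin n → Fin m → ℝ)),
      ContDiff ℝ (⊤ : ℕ∞) Z → HasCompactSupport Z → ContDiff ℝ (⊤ : ℕ∞) W → HasCompactSupport W →
      HasDerivAt
        (fun t : ℝ => ∫ x : Fin m → ℝ,
          ((∑ A : Fin n, ∑ ν : Fin m,
              (p x A ν + t * W x A ν) * pd (fun x' => y x' A + t * Z x' A) ν x)
            - h (x, y x + t • Z x, p x + t • W x)
          - ((∑ A : Fin n, ∑ ν : Fin m, p x A ν * pd (fun x' => y x' A) ν x)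
            - h (x, y x, p x)))) 0 0) ↔
    ((∀ (x : Fin m → ℝ) (A : Fin n) (ν : Fin m),
        pd (fun x' => y x' A) ν x = Lv h (x, y x, p x) A ν) ∧
      (∀ (x : Fin m → ℝ) (A : Fin n),
        ∑ ν : Fin m, pd (fun x' => p x' A ν) ν x = - Ly h (x, y x, p x) A)) := by
  have hz : Continuous fun x => (x, y x, p x) :=
    continuous_id.prodMk (hy.continuous.prodMk hp.continuous)
  constructor
  · intro H
    have key : ∀ (Z : (Fin m → ℝ) → (Fin n → ℝ)) (W : (Fin m → ℝ) → (Fin n → Fin m → ℝ)),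
        ContDiff ℝ (⊤ : ℕ∞) Z → HasCompactSupport Z → ContDiff ℝ (⊤ : ℕ∞) W →
        HasCompactSupport W →
        (∑ A, ∑ ν, ∫ x, W x A ν * (pd (fun x' => y x' A) ν x - Lv h (x, y x, p x) A ν)) -
          ∑ A, ∫ x, Z x A * (∑ ν, pd (fun x' => p x' A ν) ν x + Ly h (x, y x, p x) A) = 0 := by
      intro Z W hZ hZs hW hWs
      rw [← integral_hamiltonian_variation hh hy hp hZ hZs hW hWs]
      exact (hasDerivAt_hamiltonian_action hh hy hp hZ hZs hW hWs).unique (H Z W hZ hZs hW hWs)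
    refine ⟨fun x A ν => ?_, fun x A => ?_⟩
    · refine sub_eq_zero.1 (eq_zero_of_forall_integral_smooth_mul_eq_zero
        (f := fun x => pd (fun x' => y x' A) ν x - Lv h (x, y x, p x) A ν)
        ((continuous_pd (contDiff_pi.1 hy A) ν).sub (continuous_Lv_comp hh hz A ν))
        (fun g hg hgs => ?_) x)
      have := key 0 (fun x => Pi.single A (Pi.single ν (g x))) contDiff_const
        HasCompactSupport.zero
        (contDiff_pi.2 fun B => contDiff_pi.2 fun μ => by
          by_cases hB : B = A
          · subst hB
            by_cases hμ : μ = ν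
            · subst hμ
              simpa using hg
            · simpa [hμ] using contDiff_const
          · simpa [hB] using contDiff_const)
        (hgs.comp_left (g := fun r : ℝ => (Pi.single A (Pi.single ν r) : Fin n → Fin m → ℝ))
          (by simp))
      rw [Finset.sum_eq_single A (by intro B _ hB; simp [hB]) (by simp),
        Finset.sum_eq_single ν (by intro μ _ hμ; simp [hμ]) (by simp)] at this
      simpa using this
    · refine eq_neg_of_add_eq_zero_left (eq_zero_of_forall_integral_smooth_mul_eq_zero
        (f := fun x => ∑ ν, pd (fun x' => p x' A ν) ν x + Ly h (x, y x, p x) A)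
        ((continuous_finsetSum _ fun ν _ =>
          continuous_pd (contDiff_pi.1 (contDiff_pi.1 hp A) ν) ν).add
          (continuous_Ly_comp hh hz A)) (fun g hg hgs => ?_) x)
      have := key (fun x => Pi.single A (g x)) 0
        (contDiff_pi.2 fun B => by
          by_cases hB : B = A
          · subst hB
            simpa using hg
          · simpa [hB] using contDiff_const)
        (hgs.comp_left (g := fun r : ℝ => (Pi.single A r : Fin n → ℝ)) (by simp)) contDiff_const
        HasCompactSupport.zero
      simp only [Pi.zero_apply, zero_mul, integral_zero, Finset.sum_const_zero, zero_sub,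
        neg_eq_zero] at this
      rw [Finset.sum_eq_single A (by intro B _ hB; simp [hB]) (by simp)] at this
      simpa using this
  · rintro ⟨h1, h2⟩ Z W hZ hZs hW hWs
    have := hasDerivAt_hamiltonian_action hh hy hp hZ hZs hW hWs
    rw [integral_hamiltonian_variation hh hy hp hZ hZs hW hWs] at this
    simpa [h1, h2] using this
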